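/- Let A be a C*-algebra, let 0 < r ≤ 1, and let (φ_m)_{m∈ℕ} be a sequence of continuous linear functionals on A with ‖φ_m‖ = 1 for all m, spanning ℓ1 r-isomorphically. Then for every ε > 0 there exist a strictly increasing sequence (m_n) of natural numbers and a sequence (c_n) of pairwise orthogonal elements of A (c_n·c_k* = 0 and c_k*·c_n = 0 for n ≠ k) with ‖c_n‖ = 1 and Re φ_{m_n}(c_n) > r(1 − ε) for every n, such that moreover for every finitely supported family of complex scalars (α_n) there exists an element c in the closed linear span of {c_k : k ∈ ℕ} with ‖c‖ ≤ 1 and |∑_n α_n φ_{m_n}(c)| ≥ r(1 − ε) ∑_n |α_n|; in particular the restrictions of the φ_{m_n} to the closed linear span of the c_k span ℓ1 r(1 − ε)-isomorphically. -/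

import Mathlib

section aux
variable {A : Type*} [NonUnitalCStarAlgebra A]

theorem aux_add_sq [PartialOrder A] [StarOrderedRing A] {t t' : ℝ} {z z' b b' : A}
    (h2 : 0 ≤ t) (hb : 0 ≤ b) (h3 : star z * z ≤ t • b)
    (h2' : 0 ≤ t') (hb' : 0 ≤ b') (h3' : star z' * z' ≤ t' • b') :
    star (z + z') * (z + z') ≤ (t + t') • (b + b') := by
  have key0 : ∀ {z : A}, star z * z ≤ (0 : ℝ) • b → z = 0 := by
    intro z h
    rw [zero_smul] at h
    simpa using le_antisymm h (star_mul_self_nonneg z)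
  have key0' : ∀ {z : A}, star z * z ≤ (0 : ℝ) • b' → z = 0 := by
    intro z h
    rw [zero_smul] at h
    simpa using le_antisymm h (star_mul_self_nonneg z)
  rcases eq_or_lt_of_le h2 with h0 | h0
  · subst h0
    rw [key0 h3, zero_add, zero_add, smul_add]
    exact h3'.trans (le_add_of_nonneg_left (smul_nonneg h2' hb))
  rcases eq_or_lt_of_le h2' with h0' | h0'
  · subst h0'
    rw [key0' h3', add_zero, add_zero, smul_add]
    exact h3.trans (le_add_of_nonneg_right (smul_nonneg h2 hb'))
  have hpos : 0 < t * t' := by positivity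
  rw [← smul_le_smul_iff_of_pos_left hpos]
  have e1 := star_mul_self_nonneg (t' • z - t • z')
  have e2 := smul_le_smul_of_nonneg_left h3 (show 0 ≤ t' * (t + t') by positivity)
  have e3 := smul_le_smul_of_nonneg_left h3' (show 0 ≤ t * (t + t') by positivity)
  rw [← sub_nonneg] at e2 e3 ⊢
  have e4 := add_nonneg e1 (add_nonneg e2 e3)
  convert e4 using 1
  simp only [star_sub, star_smul, star_trivial, sub_mul, mul_sub, smul_mul_assoc, mul_smul_comm,
    star_add, add_mul, mul_add]
  module

/-- positive dominating functional (right version) -/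
theorem aux_dominate_right (φ : A →L[ℂ] ℂ) (hφ : ‖φ‖ ≤ 1) :
    ∃ ψ : A →ₗ[ℝ] ℝ, (∀ a, ψ a ≤ ‖a‖) ∧
      ∀ x e, ‖x‖ ≤ 1 → ‖φ (x * e)‖ ^ 2 ≤ ψ (star e * e) := by
  let _ := CStarAlgebra.spectralOrder A
  have _ := CStarAlgebra.spectralOrderedRing A
  have hφn : ∀ x, ‖φ x‖ ≤ ‖x‖ := fun x => (φ.le_of_opNorm_le hφ x).trans (by simp)
  let s : PointedCone ℝ (A × ℝ) :=
    { carrier := {p | ∃ (b : A) (t : ℝ) (z : A), φ z = t ∧ 0 ≤ t ∧ 0 ≤ b ∧ star z * z ≤ t • b ∧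
        ‖p.1 + b‖ - t ≤ p.2}
      zero_mem' := ⟨0, 0, 0, by simp⟩
      add_mem' := by
        rintro ⟨a₁, u₁⟩ ⟨a₂, u₂⟩ ⟨b, t, z, h1, h2, hb, h3, h4⟩ ⟨b', t', z', h1', h2', hb', h3', h4'⟩
        refine ⟨b + b', t + t', z + z', by simp [h1, h1'], by positivity, add_nonneg hb hb',
          aux_add_sq h2 hb h3 h2' hb' h3', ?_⟩
        have : a₁ + a₂ + (b + b') = (a₁ + b) + (a₂ + b') := by abel
        have h5 := norm_add_le (a₁ + b) (a₂ + b')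
        simp only [Prod.mk_add_mk, this] at *
        linarith
      smul_mem' := by
        rintro ⟨c, hc⟩ ⟨a, u⟩ ⟨b, t, z, h1, h2, hb, h3, h4⟩
        refine ⟨c • b, c * t, (c : ℂ) • z, ?_, by positivity, smul_nonneg hc hb, ?_, ?_⟩
        · simp [h1]
        · have := smul_le_smul_of_nonneg_left h3 (show 0 ≤ c * c by positivity)
          convert this using 1
          · simp only [star_smul, smul_mul_assoc, mul_smul_comm, smul_smul]
            simp
            rw [← Complex.coe_smul]; simp
          · module
        · have : c • a + c • b = c • (a + b) := by module
          have h5 : ‖c • (a + b)‖ = c * ‖a + b‖ := by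
            rw [norm_smul, Real.norm_of_nonneg hc]
          change ‖c • a + c • b‖ - c * t ≤ c * u
          rw [this, h5]
          change ‖a + b‖ - t ≤ u at h4
          nlinarith }
  have hs : ∀ p : A × ℝ, p ∈ s ↔ ∃ (b : A) (t : ℝ) (z : A), φ z = t ∧ 0 ≤ t ∧ 0 ≤ b ∧
      star z * z ≤ t • b ∧ ‖p.1 + b‖ - t ≤ p.2 := fun p => Iff.rfl
  let f : (A × ℝ) →ₗ.[ℝ] ℝ :=
    { domain := LinearMap.range (LinearMap.inr ℝ A ℝ)
      toFun := (LinearMap.snd ℝ A ℝ).comp (Submodule.subtype _) }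
  obtain ⟨g, hg1, hg2⟩ := riesz_extension s f (by
    rintro ⟨⟨a, u⟩, ⟨v, hv⟩⟩ hx
    obtain ⟨rfl, rfl⟩ := Prod.mk.inj hv
    obtain ⟨b, t, z, h1, h2, hb, h3, h4⟩ := (hs _).1 hx
    change 0 ≤ v
    have h4 : ‖(0 : A) + b‖ - t ≤ v := h4
    rw [zero_add] at h4
    have h5 : t ≤ ‖z‖ := by
      have := hφn z
      rw [h1, Complex.norm_real, Real.norm_of_nonneg h2] at this
      exact this
    have h6 : ‖z‖ * ‖z‖ ≤ t * ‖b‖ := by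
      have h7 : ‖t • b‖ = t * ‖b‖ := by rw [norm_smul, Real.norm_of_nonneg h2]
      rw [← CStarRing.norm_star_mul_self, ← h7]
      exact CStarAlgebra.norm_le_norm_of_nonneg_of_le (star_mul_self_nonneg z) h3
    rcases eq_or_lt_of_le h2 with h0 | h0
    · have := norm_nonneg b
      linarith
    · nlinarith) (by
    rintro ⟨a, u⟩
    refine ⟨⟨(0, ‖a‖ - u), ⟨_, rfl⟩⟩, (hs _).2 ⟨0, 0, 0, by simp⟩⟩)
  have hg3 : ∀ u : ℝ, g (0, u) = u := fun u => hg1 ⟨(0, u), ⟨u, rfl⟩⟩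
  have hg4 : ∀ a u, g (a, u) = g (a, 0) + u := by
    intro a u
    rw [← hg3 u, ← map_add]; simp [hg3]
  refine ⟨-(g.comp (LinearMap.inl ℝ A ℝ)), fun a => ?_, fun x e hx => ?_⟩
  · have := hg2 (a, ‖a‖) ((hs _).2 ⟨0, 0, 0, by simp⟩)
    rw [hg4] at this
    simp
    linarith
  · have := hg2 (-(star e * e), - ‖φ (x * e)‖ ^ 2) ((hs _).2
      ⟨star e * e, ‖φ (x * e)‖ ^ 2, (starRingEnd ℂ (φ (x * e))) • (x * e), ?_, by positivity,
        star_mul_self_nonneg e, ?_, by simp⟩)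
    · rw [hg4] at this
      have h7 : g (-(star e * e), 0) = - g (star e * e, 0) := by
        rw [← map_neg]; simp
      simp
      linarith
    · simp [Complex.conj_mul']
    · have h8 : star ((starRingEnd ℂ (φ (x * e))) • (x * e)) * ((starRingEnd ℂ (φ (x * e))) • (x * e))
          = (‖φ (x * e)‖ ^ 2) • (star e * (star x * x) * e) := by
        simp only [star_smul, smul_mul_assoc, mul_smul_comm, smul_smul, star_mul, mul_assoc]
        rw [← Complex.coe_smul]
        congr 1
        simp [Complex.conj_mul']
      rw [h8]
      refine smul_le_smul_of_nonneg_left ?_ (by positivity)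
      have h9 := CStarAlgebra.star_left_conjugate_le_norm_smul (a := e) (b := star x * x)
        (IsSelfAdjoint.star_mul_self x)
      refine h9.trans ?_
      have h10 : ‖star x * x‖ ≤ 1 := by
        rw [CStarRing.norm_star_mul_self]; nlinarith [norm_nonneg x]
      have := smul_le_smul_of_nonneg_right h10 (star_mul_self_nonneg e)
      simpa using this

/-- positive dominating functional (left version) -/
theorem aux_dominate_left (φ : A →L[ℂ] ℂ) (hφ : ‖φ‖ ≤ 1) :
    ∃ ψ : A →ₗ[ℝ] ℝ, (∀ a, ψ a ≤ ‖a‖) ∧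
      ∀ x e, ‖x‖ ≤ 1 → ‖φ (e * x)‖ ^ 2 ≤ ψ (e * star e) := by
  have hφn : ∀ x, ‖φ x‖ ≤ ‖x‖ := fun x => (φ.le_of_opNorm_le hφ x).trans (by simp)
  let φ' : A →L[ℂ] ℂ := LinearMap.mkContinuous
    { toFun := fun x => star (φ (star x))
      map_add' := by intro x y; simp
      map_smul' := by intro c x; simp } 1 (by
        intro x
        have := hφn (star x)
        rw [norm_star] at this
        simpa using this)
  obtain ⟨ψ, h1, h2⟩ := aux_dominate_right φ' (LinearMap.mkContinuous_norm_le _ zero_le_one _)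
  refine ⟨ψ, h1, fun x e hx => ?_⟩
  have h3 := h2 (star x) (star e) (by simpa using hx)
  have h4 : φ' (star x * star e) = star (φ (e * x)) := by
    change star (φ (star (star x * star e))) = _
    simp
  rw [h4] at h3
  simpa using h3

theorem aux_norm_sum {ι : Type*} (s : Finset ι) (c : ι → A) (θ : ι → ℂ)
    (horth : ∀ n k, n ≠ k → c n * star (c k) = 0 ∧ star (c k) * c n = 0)
    (hc : ∀ n, ‖c n‖ = 1) (hθ : ∀ n, ‖θ n‖ ≤ 1) : ‖∑ n ∈ s, θ n • c n‖ ≤ 1 := by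
  have h1 : star (∑ n ∈ s, θ n • c n) * (∑ n ∈ s, θ n • c n)
      = ∑ n ∈ s, star (θ n • c n) * (θ n • c n) := by
    rw [star_sum, Finset.sum_mul]
    refine Finset.sum_congr rfl fun i hi => ?_
    rw [Finset.mul_sum, Finset.sum_eq_single_of_mem i hi]
    intro j hj hji
    rw [star_smul, smul_mul_smul_comm, (horth j i hji).2, smul_zero]
  have h2 := IsSelfAdjoint.nnnorm_sum_eq_sup (f := fun n => star (θ n • c n) * (θ n • c n)) s
    (fun i _ => IsSelfAdjoint.star_mul_self _) (by
      intro i j hij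
      change star (θ i • c i) * (θ i • c i) * (star (θ j • c j) * (θ j • c j)) = 0
      have : (θ i • c i) * (star (θ j • c j)) = 0 := by
        rw [star_smul, smul_mul_smul_comm, (horth i j hij).1, smul_zero]
      rw [mul_assoc, ← mul_assoc (θ i • c i), this]; simp)
  have h3 : ‖∑ n ∈ s, star (θ n • c n) * (θ n • c n)‖₊ ≤ 1 := by
    rw [h2]
    refine Finset.sup_le fun i _ => ?_
    rw [CStarRing.nnnorm_star_mul_self]
    have : ‖θ i • c i‖₊ ≤ 1 := by
      rw [← NNReal.coe_le_coe]
      simp [norm_smul, hc, hθ]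
    exact mul_le_one' this this
  rw [← h1, CStarRing.nnnorm_star_mul_self, ← NNReal.coe_le_coe] at h3
  simp at h3
  nlinarith [norm_nonneg (∑ n ∈ s, θ n • c n)]
end aux
section aux2

theorem aux_sign_step {E : Type*} [AddCommGroup E] [Module ℝ E] (q : Seminorm ℝ E)
    (hq : ∀ x y, q (x + y) ^ 2 + q (x - y) ^ 2 = 2 * q x ^ 2 + 2 * q y ^ 2)
    (G g : E →ₗ[ℝ] ℝ) (D C : ℝ)  (hG : ∀ x, G x ≤ D * q x) (hg : ∀ x, g x ≤ C * q x) :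
    (∀ x, (G + g) x ≤ √(D ^ 2 + C ^ 2) * q x) ∨ (∀ x, (G - g) x ≤ √(D ^ 2 + C ^ 2) * q x) := by
  by_contra hcon
  rw [not_or] at hcon
  push Not at hcon
  obtain ⟨⟨x, hx⟩, ⟨y, hy⟩⟩ := hcon
  have hS : 0 ≤ √(D ^ 2 + C ^ 2) := Real.sqrt_nonneg _
  have hS2 : √(D ^ 2 + C ^ 2) ^ 2 = D ^ 2 + C ^ 2 := Real.sq_sqrt (by positivity)
  set S := √(D ^ 2 + C ^ 2)
  have hgn : ∀ x, -g x ≤ C * q x := fun x => by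
    have := hg (-x); rwa [map_neg, map_neg_eq_map] at this
  have hx0 : 0 < q x := by
    rcases eq_or_lt_of_le (apply_nonneg q x) with h | h
    · exfalso
      have h1 := hG x
      have h2 := hg x
      rw [← h] at h1 h2 hx
      simp at hx h1 h2
      linarith
    · exact h
  have hy0 : 0 < q y := by
    rcases eq_or_lt_of_le (apply_nonneg q y) with h | h
    · exfalso
      have h1 := hG y
      have h2 := hgn y
      rw [← h] at h1 h2 hy
      simp at hy h1 h2
      linarith
    · exact h
  -- normalise
  have hxn : q ((q x)⁻¹ • x) = 1 := by
    rw [map_smul_eq_mul, norm_inv, Real.norm_of_nonneg hx0.le, inv_mul_cancel₀ hx0.ne']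
  have hyn : q ((q y)⁻¹ • y) = 1 := by
    rw [map_smul_eq_mul, norm_inv, Real.norm_of_nonneg hy0.le, inv_mul_cancel₀ hy0.ne']
  have hx' : S < (G + g) ((q x)⁻¹ • x) := by
    rw [map_smul, smul_eq_mul, lt_inv_mul_iff₀ hx0]; linarith
  have hy' : S < (G - g) ((q y)⁻¹ • y) := by
    rw [map_smul, smul_eq_mul, lt_inv_mul_iff₀ hy0]; linarith
  generalize (q x)⁻¹ • x = u at *
  generalize (q y)⁻¹ • y = v at *
  have h1 := hG (u + v)
  have h2 := hg (u - v)
  have h3 := hq u v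
  rw [hxn, hyn] at h3
  simp only [map_add, map_sub, LinearMap.add_apply, LinearMap.sub_apply] at *
  have h4 : 2 * S < D * q (u + v) + C * q (u - v) := by linarith
  have h5 : (D * q (u + v) + C * q (u - v)) ^ 2 ≤ (2 * S) ^ 2 := by
    nlinarith [sq_nonneg (D * q (u - v) - C * q (u + v))]
  have := (le_abs_self _).trans (abs_le_of_sq_le_sq h5 (by positivity))
  linarith

theorem aux_signs {E ι : Type*} [AddCommGroup E] [Module ℝ E] (q : Seminorm ℝ E)
    (hq : ∀ x y, q (x + y) ^ 2 + q (x - y) ^ 2 = 2 * q x ^ 2 + 2 * q y ^ 2)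
    (g : ι → E →ₗ[ℝ] ℝ) (s : Finset ι) (hg : ∀ i ∈ s, ∀ x, g i x ≤ q x) :
    ∃ σ : ι → ℝ, (∀ i, |σ i| = 1) ∧ ∀ x, ∑ i ∈ s, σ i * g i x ≤ √(s.card) * q x := by
  classical
  induction s using Finset.induction with
  | empty => exact ⟨fun _ => 1, by simp, by simp⟩
  | insert j s hj ih =>
    obtain ⟨σ, h1, h2⟩ := ih fun i hi => hg i (Finset.mem_insert_of_mem hi)
    have key := aux_sign_step q hq (∑ i ∈ s, σ i • g i) (g j) (√(s.card)) 1 (by intro x; simpa using h2 x)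
      (by intro x; simpa using hg j (Finset.mem_insert_self _ _) x)
    have hc : √(√(s.card : ℝ) ^ 2 + 1 ^ 2) = √((insert j s).card) := by
      rw [Real.sq_sqrt (by positivity), Finset.card_insert_of_notMem hj]; simp
    rw [hc] at key
    have hs : ∀ (t : ℝ) x, ∑ i ∈ s, Function.update σ j t i * g i x = ∑ i ∈ s, σ i * g i x := by
      intro t x
      refine Finset.sum_congr rfl fun i hi => ?_
      rw [Function.update_of_ne]
      rintro rfl; exact hj hi
    have hu : ∀ t : ℝ, |t| = 1 → ∀ i, |Function.update σ j t i| = 1 := by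
      intro t ht i
      rcases eq_or_ne i j with rfl | h
      · simpa using ht
      · simpa [h] using h1 i
    rcases key with key | key
    · refine ⟨Function.update σ j 1, hu _ (by simp), fun x => ?_⟩
      rw [Finset.sum_insert hj, hs]
      have := key x
      simp at this
      simp
      linarith
    · refine ⟨Function.update σ j (-1), hu _ (by simp), fun x => ?_⟩
      rw [Finset.sum_insert hj, hs]
      have := key x
      simp at this
      simp
      linarith

theorem aux_split {E : Type*} [AddCommGroup E] [Module ℝ E] (p q : Seminorm ℝ E)
    (f : E →ₗ[ℝ] ℝ) (hf : ∀ x, f x ≤ p x + q x) :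
    ∃ a g : E →ₗ[ℝ] ℝ, (∀ x, f x = a x + g x) ∧ (∀ x, a x ≤ p x) ∧ ∀ x, g x ≤ q x := by
  let F : (E × E) →ₗ.[ℝ] ℝ :=
    { domain := LinearMap.range (LinearMap.prod LinearMap.id LinearMap.id : E →ₗ[ℝ] E × E)
      toFun := (f.comp (LinearMap.fst ℝ E E)).comp (Submodule.subtype _) }
  obtain ⟨G, h1, h2⟩ := exists_extension_of_le_sublinear F (fun z => p z.1 + q z.2)
    (by
      intro c hc x
      simp [map_smul_eq_mul, abs_of_pos hc]; ring)
    (by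
      intro x y
      have := map_add_le_add p x.1 y.1
      have := map_add_le_add q x.2 y.2
      simp only [Prod.fst_add, Prod.snd_add]
      linarith)
    (by
      rintro ⟨_, ⟨x, rfl⟩⟩
      exact hf x)
  refine ⟨G.comp (LinearMap.inl ℝ E E), G.comp (LinearMap.inr ℝ E E), fun x => ?_, fun x => ?_,
    fun x => ?_⟩
  · have := h1 ⟨(x, x), ⟨x, rfl⟩⟩
    change G (x, x) = f x at this
    rw [← this]
    simp [← map_add]
  · simpa using h2 (x, 0)
  · simpa using h2 (0, x)

theorem aux_type2 {E ι : Type*} [AddCommGroup E] [Module ℝ E] (p q : Seminorm ℝ E)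
    (hq : ∀ x y, q (x + y) ^ 2 + q (x - y) ^ 2 = 2 * q x ^ 2 + 2 * q y ^ 2)
    (f : ι → E →ₗ[ℝ] ℝ) (s : Finset ι) (hf : ∀ i ∈ s, ∀ x, f i x ≤ p x + q x) :
    ∃ σ : ι → ℝ, (∀ i, |σ i| = 1) ∧
      ∀ x, ∑ i ∈ s, σ i * f i x ≤ s.card * p x + √(s.card) * q x := by
  have : ∀ i, ∃ a g : E →ₗ[ℝ] ℝ, i ∈ s →
      (∀ x, f i x = a x + g x) ∧ (∀ x, a x ≤ p x) ∧ ∀ x, g x ≤ q x := by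
    intro i
    by_cases hi : i ∈ s
    · obtain ⟨a, g, h⟩ := aux_split p q (f i) (hf i hi)
      exact ⟨a, g, fun _ => h⟩
    · exact ⟨0, 0, fun h => absurd h hi⟩
  choose a g h using this
  obtain ⟨σ, h1, h2⟩ := aux_signs q hq g s fun i hi => (h i hi).2.2
  refine ⟨σ, h1, fun x => ?_⟩
  have h3 : ∑ i ∈ s, σ i * f i x = ∑ i ∈ s, σ i * a i x + ∑ i ∈ s, σ i * g i x := by
    rw [← Finset.sum_add_distrib]
    refine Finset.sum_congr rfl fun i hi => ?_
    rw [(h i hi).1]; ring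
  have h4 : ∑ i ∈ s, σ i * a i x ≤ s.card * p x := by
    rw [← nsmul_eq_mul]
    refine Finset.sum_le_card_nsmul _ _ _ fun i hi => ?_
    have e1 := (h i hi).2.1 x
    have e2 := (h i hi).2.1 (-x)
    rw [map_neg, map_neg_eq_map] at e2
    calc σ i * a i x ≤ |σ i * a i x| := le_abs_self _
      _ = |a i x| := by rw [abs_mul, h1, one_mul]
      _ ≤ _ := abs_le.2 ⟨by linarith, e1⟩
  linarith [h2 x]
end aux2

section aux3
variable {A : Type*} [NonUnitalCStarAlgebra A]

theorem aux_funcs (η : ℝ) (hη : 0 < η) :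
    ∃ F H F' H' : ℝ → ℝ, Continuous F ∧ Continuous H ∧ Continuous F' ∧ Continuous H' ∧
      F 0 = 0 ∧ H 0 = 0 ∧ F' 0 = 0 ∧ H' 0 = 0 ∧ (∀ t, F t * H t = F t) ∧
      (∀ t, 0 ≤ H t ∧ H t ≤ 1) ∧ (∀ t, 0 ≤ F t ∧ F t ≤ 1) ∧
      (∀ t, 0 ≤ t → H t * H t ≤ 2 / η ^ 2 * t) ∧
      (∀ t, 0 ≤ t → t * (1 - F t) ^ 2 ≤ η ^ 2) ∧
      (∀ t, F t = F' t * t) ∧ (∀ t, H t = H' t * t) := by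
  have hη2 : 0 < η ^ 2 := by positivity
  have hmax : ∀ t, 0 < max t (η ^ 2) := fun t => lt_max_of_lt_right hη2
  have hmax' : ∀ t, 0 < max t (η ^ 2 / 2) := fun t => lt_max_of_lt_right (by positivity)
  obtain ⟨F, hF⟩ : ∃ F : ℝ → ℝ, F = fun t => 1 - η ^ 2 / max t (η ^ 2) := ⟨_, rfl⟩
  obtain ⟨H, hH⟩ : ∃ H : ℝ → ℝ, H = fun t => max 0 (min 1 (2 * t / η ^ 2 - 1)) := ⟨_, rfl⟩
  obtain ⟨F', hF'⟩ : ∃ F' : ℝ → ℝ, F' = fun t => F t / max t (η ^ 2) := ⟨_, rfl⟩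
  obtain ⟨H', hH'⟩ : ∃ H' : ℝ → ℝ, H' = fun t => H t / max t (η ^ 2 / 2) := ⟨_, rfl⟩
  have cF : Continuous F := by
    rw [hF]
    exact continuous_const.sub (continuous_const.div (by fun_prop) fun t => (hmax t).ne')
  have cH : Continuous H := by rw [hH]; fun_prop
  have cF' : Continuous F' := by
    rw [hF']; exact cF.div (by fun_prop) fun t => (hmax t).ne'
  have cH' : Continuous H' := by
    rw [hH']; exact cH.div (by fun_prop) fun t => (hmax' t).ne'
  have F0 : F 0 = 0 := by simp [hF, max_eq_right hη2.le, hη2.ne']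
  have H0 : H 0 = 0 := by simp [hH]
  have F'0 : F' 0 = 0 := by simp [hF', F0]
  have H'0 : H' 0 = 0 := by simp [hH', H0]
  have hFlow : ∀ t, t ≤ η ^ 2 → F t = 0 := by
    intro t ht; simp [hF, max_eq_right ht, hη.ne']
  have hFhigh : ∀ t, η ^ 2 ≤ t → F t = 1 - η ^ 2 / t := by
    intro t ht; simp [hF, max_eq_left ht]
  have hHlow : ∀ t, t ≤ η ^ 2 / 2 → H t = 0 := by
    intro t ht
    have : 2 * t / η ^ 2 - 1 ≤ 0 := by
      rw [sub_nonpos, div_le_one hη2]; linarith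
    simp [hH, this]
  have hHhigh : ∀ t, η ^ 2 ≤ t → H t = 1 := by
    intro t ht
    have : 1 ≤ 2 * t / η ^ 2 - 1 := by
      rw [le_sub_iff_add_le, le_div_iff₀ hη2]; linarith
    simp [hH, min_eq_left this]
  have hH01 : ∀ t, 0 ≤ H t ∧ H t ≤ 1 := by
    intro t; simp [hH]
  have hF01 : ∀ t, 0 ≤ F t ∧ F t ≤ 1 := by
    intro t
    rw [hF]
    have h1 : η ^ 2 / max t (η ^ 2) ≤ 1 := by rw [div_le_one (hmax t)]; exact le_max_right _ _
    have h2 : 0 ≤ η ^ 2 / max t (η ^ 2) := div_nonneg hη2.le (hmax t).le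
    constructor <;> simp only <;> linarith
  have hHt : ∀ t, 0 ≤ t → H t * H t ≤ 2 / η ^ 2 * t := by
    intro t ht
    have h1 : H t ≤ 2 / η ^ 2 * t := by
      rw [hH]
      refine max_le (by positivity) (min_le_of_right_le ?_)
      have : 2 * t / η ^ 2 = 2 / η ^ 2 * t := by ring
      linarith
    nlinarith [hH01 t]
  refine ⟨F, H, F', H', cF, cH, cF', cH', F0, H0, F'0, H'0, ?_, hH01, hF01, hHt, ?_, ?_, ?_⟩
  · intro t
    rcases le_total t (η ^ 2) with h | h
    · simp [hFlow t h]
    · simp [hHhigh t h]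
  · intro t h0
    rcases le_total t (η ^ 2) with h | h
    · simpa [hFlow t h] using h
    · have ht0 : 0 < t := lt_of_lt_of_le hη2 h
      rw [hFhigh t h]
      have : t * (1 - (1 - η ^ 2 / t)) ^ 2 = η ^ 2 * (η ^ 2 / t) := by field_simp; ring
      rw [this]
      have : η ^ 2 / t ≤ 1 := by rw [div_le_one ht0]; exact h
      nlinarith
  · intro t
    rcases le_total t (η ^ 2) with h | h
    · simp [hF', hFlow t h]
    · have : t ≠ 0 := (lt_of_lt_of_le hη2 h).ne'
      simp [hF', max_eq_left h, this]
  · intro t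
    rcases le_total t (η ^ 2 / 2) with h | h
    · simp [hH', hHlow t h]
    · have : t ≠ 0 := (lt_of_lt_of_le (by positivity) h).ne'
      simp [hH', max_eq_left h, this]

theorem aux_cfc (x : A) (η : ℝ) (hη : 0 < η) :
    ∃ f e : A, star f = f ∧ star e = e ∧ f * e = f ∧ ‖f‖ ≤ 1 ∧ ‖x - x * f‖ ≤ η ∧
      (∃ z, (2 / η ^ 2) • (star x * x) - e * e = star z * z) ∧ (∀ y, ‖y - y * e‖ ≤ ‖y‖) ∧
      (∃ g, f = g * (star x * x)) ∧ (∃ g, e = g * (star x * x)) := by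
  let _ := CStarAlgebra.spectralOrder A
  have _ := CStarAlgebra.spectralOrderedRing A
  have ha : 0 ≤ star x * x := star_mul_self_nonneg x
  have hsa : IsSelfAdjoint (star x * x) := IsSelfAdjoint.star_mul_self x
  have hsp : ∀ t ∈ quasispectrum ℝ (star x * x), 0 ≤ t := fun t ht =>
    quasispectrum_nonneg_of_nonneg _ ha t ht
  obtain ⟨F, H, F', H', cF, cH, cF', cH', F0, H0, F'0, H'0, hFH, hH01, hF01, hHt, hFt, hF', hH'⟩ :=
    aux_funcs η hη
  have cF := cF.continuousOn (s := quasispectrum ℝ (star x * x))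
  have cH := cH.continuousOn (s := quasispectrum ℝ (star x * x))
  have cF' := cF'.continuousOn (s := quasispectrum ℝ (star x * x))
  have cH' := cH'.continuousOn (s := quasispectrum ℝ (star x * x))
  have cI := (continuous_id' (X := ℝ)).continuousOn (s := quasispectrum ℝ (star x * x))
  set a := star x * x with ha_def
  have sF : star (cfcₙ F a) = cfcₙ F a := IsSelfAdjoint.cfcₙ
  have sH : star (cfcₙ H a) = cfcₙ H a := IsSelfAdjoint.cfcₙ
  have hid : cfcₙ (fun t : ℝ => t) a = a := cfcₙ_id' ℝ a
  refine ⟨cfcₙ F a, cfcₙ H a, sF, sH, ?_, ?_, ?_, ?_, ?_, ⟨cfcₙ F' a, ?_⟩, ⟨cfcₙ H' a, ?_⟩⟩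
  · rw [← cfcₙ_mul F H a cF F0 cH H0]
    simp only [hFH]
  · refine norm_cfcₙ_le fun t _ => ?_
    rw [Real.norm_of_nonneg (hF01 t).1]; exact (hF01 t).2
  · have cM : ContinuousOn (fun t => t * F t) (quasispectrum ℝ a) := cI.mul cF
    have cS : ContinuousOn (fun t => t - t * F t) (quasispectrum ℝ a) := cI.sub cM
    have e : star (x - x * cfcₙ F a) * (x - x * cfcₙ F a)
        = cfcₙ (fun t => (t - t * F t) - F t * (t - t * F t)) a := by
      rw [cfcₙ_sub (fun t => t - t * F t) (fun t => F t * (t - t * F t)) a cS (by simp)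
          (cF.mul cS) (by simp),
        cfcₙ_mul F (fun t => t - t * F t) a cF F0 cS (by simp),
        cfcₙ_sub (fun t => t) (fun t => t * F t) a cI rfl cM (by simp),
        cfcₙ_mul (fun t => t) F a cI rfl cF F0, hid, star_sub, star_mul, sF, ha_def]
      simp only [sub_mul, mul_sub, mul_assoc]
      abel
    have e2 : ‖cfcₙ (fun t => (t - t * F t) - F t * (t - t * F t)) a‖ ≤ η ^ 2 := by
      refine norm_cfcₙ_le fun t ht => ?_
      have h0 := hsp t ht
      have e3 : (t - t * F t) - F t * (t - t * F t) = t * (1 - F t) ^ 2 := by ring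
      rw [e3, Real.norm_of_nonneg (by positivity)]
      exact hFt t h0
    rw [← e, CStarRing.norm_star_mul_self, ← sq] at e2
    exact (pow_le_pow_iff_left₀ (norm_nonneg _) hη.le two_ne_zero).1 e2
  · rw [← CStarAlgebra.nonneg_iff_eq_star_mul_self, ← cfcₙ_mul H H a cH H0 cH H0]
    have e : (2 / η ^ 2) • a = cfcₙ (fun t => 2 / η ^ 2 * t) a := (cfcₙ_const_mul_id _ a).symm
    rw [e, sub_nonneg]
    exact cfcₙ_mono (fun t ht => hHt t (hsp t ht)) (cH.mul cH) (continuousOn_const.mul cI)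
      (by simp [H0]) (by simp)
  · intro y
    have e1 : 0 ≤ cfcₙ (fun t => (H t + H t) - H t * H t) a :=
      cfcₙ_nonneg fun t _ => by nlinarith [hH01 t]
    rw [cfcₙ_sub (fun t => H t + H t) (fun t => H t * H t) a (cH.add cH) (by simp [H0])
      (cH.mul cH) (by simp [H0]), cfcₙ_add H H a cH H0 cH H0,
      cfcₙ_mul H H a cH H0 cH H0] at e1
    have e2 := star_right_conjugate_nonneg e1 y
    have e3 : (y - y * cfcₙ H a) * star (y - y * cfcₙ H a) ≤ y * star y := by
      rw [← sub_nonneg]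
      convert e2 using 1
      rw [star_sub, star_mul, sH]
      simp only [sub_mul, mul_sub, mul_assoc, add_mul, mul_add]
      abel
    have e4 := CStarAlgebra.norm_le_norm_of_nonneg_of_le (mul_star_self_nonneg _) e3
    rw [CStarRing.norm_self_mul_star, CStarRing.norm_self_mul_star] at e4
    nlinarith [norm_nonneg y, norm_nonneg (y - y * cfcₙ H a)]
  · have e := cfcₙ_mul F' (fun t => t) a cF' F'0 cI rfl
    rw [hid] at e
    rw [← e]
    simp only [← hF']
  · have e := cfcₙ_mul H' (fun t => t) a cH' H'0 cI rfl
    rw [hid] at e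
    rw [← e]
    simp only [← hH']
end aux3

section aux4
variable {A : Type*} [NonUnitalCStarAlgebra A]

theorem aux_seminorm (ψ ψ' : A →ₗ[ℝ] ℝ) (hψ : ∀ x, 0 ≤ ψ (star x * x))
    (hψ' : ∀ x, 0 ≤ ψ' (x * star x)) :
    ∃ q : Seminorm ℝ A, ∀ x, q x ^ 2 = ψ (star x * x) + ψ' (x * star x) := by
  obtain ⟨Q, hQ⟩ : ∃ Q : A → ℝ, Q = fun x => ψ (star x * x) + ψ' (x * star x) := ⟨_, rfl⟩
  have hQ0 : ∀ x, 0 ≤ Q x := fun x => by rw [hQ]; exact add_nonneg (hψ x) (hψ' x)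
  have hQs : ∀ (t : ℝ) x, Q (t • x) = t ^ 2 * Q x := by
    intro t x
    simp only [hQ, star_smul, star_trivial, smul_mul_smul_comm, map_smul, smul_eq_mul]
    ring
  have hQa : ∀ x y, Q (x + y) = Q x + Q y +
      (ψ (star x * y) + ψ (star y * x) + ψ' (x * star y) + ψ' (y * star x)) := by
    intro x y
    simp only [hQ, star_add, add_mul, mul_add, map_add]
    ring
  have hCS : ∀ x y, (ψ (star x * y) + ψ (star y * x) + ψ' (x * star y) + ψ' (y * star x)) ^ 2
      ≤ 4 * Q x * Q y := by
    intro x y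
    have := discrim_le_zero (a := Q y) (b := ψ (star x * y) + ψ (star y * x) + ψ' (x * star y) +
      ψ' (y * star x)) (c := Q x) (by
        intro t
        have h := hQ0 (x + t • y)
        rw [hQa, hQs] at h
        simp only [star_smul, star_trivial, smul_mul_assoc, mul_smul_comm, map_smul,
          smul_eq_mul] at h
        linarith)
    rw [discrim] at this
    linarith
  refine ⟨Seminorm.of (fun x => √(Q x)) ?_ ?_, ?_⟩
  · intro x y
    refine Real.sqrt_le_iff.2 ⟨by positivity, ?_⟩
    rw [hQa, add_sq, Real.sq_sqrt (hQ0 x), Real.sq_sqrt (hQ0 y)]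
    have h1 : (ψ (star x * y) + ψ (star y * x) + ψ' (x * star y) + ψ' (y * star x))
        ≤ 2 * √(Q x) * √(Q y) := by
      refine le_trans (le_abs_self _) (abs_le_of_sq_le_sq ?_ (by positivity))
      refine (hCS x y).trans (le_of_eq ?_)
      rw [mul_pow, mul_pow, Real.sq_sqrt (hQ0 x), Real.sq_sqrt (hQ0 y)]
      norm_num
    linarith
  · intro t x
    rw [hQs, Real.sqrt_mul (sq_nonneg t), Real.sqrt_sq_eq_abs]; rfl
  · intro x
    change √(Q x) ^ 2 = _
    rw [Real.sq_sqrt (hQ0 x), hQ]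

theorem aux_find (φ : ℕ → A →L[ℂ] ℂ) (hφ : ∀ m x, ‖φ m x‖ ≤ ‖x‖) (B : Submodule ℂ A)
    (q : Seminorm ℝ A)
    (hq : ∀ x y, q (x + y) ^ 2 + q (x - y) ^ 2 = 2 * q x ^ 2 + 2 * q y ^ 2)
    (K : ℝ) (hK0 : 0 ≤ K) (hK : ∀ x, q x ≤ K * ‖x‖) (M : Set ℕ) (hM : M.Infinite) (rr r' δ : ℝ)
    (hr' : 0 ≤ r') (hrr : r' < rr) (hδ : 0 < δ)
    (R : ∀ s : Finset ℕ, (s : Set ℕ) ⊆ M → ∀ α : ℕ → ℂ, ∀ C : ℝ, 0 ≤ C →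
      (∀ y ∈ B, ‖∑ m ∈ s, α m * φ m y‖ ≤ C * ‖y‖) → rr * ∑ m ∈ s, ‖α m‖ ≤ C) :
    ∃ m ∈ M, ∃ x ∈ B, ‖x‖ ≤ 1 ∧ q x < δ ∧ r' < (φ m x).re := by
  by_contra hcon
  push Not at hcon
  let ι : B →ₗ[ℝ] A := (B.subtype).restrictScalars ℝ
  let p₁ : Seminorm ℝ B := r'.toNNReal • normSeminorm ℝ B
  let q₁ : Seminorm ℝ B := (δ⁻¹).toNNReal • q.comp ι
  have hp₁ : ∀ y : B, p₁ y = r' * ‖(y : A)‖ := fun y => by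
    change ((r'.toNNReal : NNReal) : ℝ) * ‖(y : A)‖ = _
    rw [Real.coe_toNNReal _ hr']
  have hq₁ : ∀ y : B, q₁ y = δ⁻¹ * q (y : A) := fun y => by
    change (((δ⁻¹).toNNReal : NNReal) : ℝ) * q (y : A) = _
    rw [Real.coe_toNNReal _ (by positivity)]
  let f : ℕ → B →ₗ[ℝ] ℝ := fun m => Complex.reLm.comp (((φ m).toLinearMap.restrictScalars ℝ).comp ι)
  have hf : ∀ m (y : B), f m y = (φ m (y : A)).re := fun m y => rfl
  have hre : ∀ m (x : A), (φ m x).re ≤ ‖x‖ := fun m x => (Complex.re_le_norm _).trans (hφ m x)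
  obtain ⟨N, hN⟩ := exists_nat_gt ((K / δ / (rr - r')) ^ 2 + 1)
  obtain ⟨s, hsM, hsN⟩ := hM.exists_subset_card_eq N
  obtain ⟨σ, h1, h2⟩ := aux_type2 p₁ q₁ (by
    intro x y
    have := hq x y
    simp only [hq₁, Submodule.coe_add, Submodule.coe_sub, mul_pow]
    linear_combination (δ⁻¹ ^ 2) * this) f s (by
    intro m hm y
    rw [hp₁, hq₁, hf]
    rcases lt_or_ge (q (y : A)) (δ * ‖(y : A)‖) with h | h
    · have hy : 0 < ‖(y : A)‖ := by
        rcases eq_or_lt_of_le (norm_nonneg (y : A)) with h0 | h0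
        · rw [← h0, mul_zero] at h
          exact absurd h (not_lt.2 (apply_nonneg q _))
        · exact h0
      have h3 := hcon m (hsM hm) (((‖(y : A)‖⁻¹ : ℝ) : ℂ) • (y : A)) (B.smul_mem _ y.2)
        (by rw [norm_smul]; simp [hy.ne']) (by
          rw [Complex.coe_smul, map_smul_eq_mul, norm_inv, norm_norm, inv_mul_lt_iff₀ hy]
          linarith)
      rw [map_smul, smul_eq_mul, Complex.re_ofReal_mul, inv_mul_le_iff₀ hy] at h3
      have : 0 ≤ δ⁻¹ * q (y : A) := mul_nonneg (by positivity) (apply_nonneg q _)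
      linarith
    · have h3 : ‖(y : A)‖ ≤ δ⁻¹ * q (y : A) := by
        rw [le_inv_mul_iff₀ hδ]; exact h
      have := hre m (y : A)
      have : 0 ≤ r' * ‖(y : A)‖ := by positivity
      linarith)
  have h3 := R s hsM (fun m => (σ m : ℂ)) (N * r' + √N * (δ⁻¹ * K)) (by positivity) (by
    intro y hy
    obtain ⟨u, hu1, hu2⟩ : ∃ u : ℂ, ‖u‖ = 1 ∧ u * ∑ m ∈ s, (σ m : ℂ) * φ m y =
        (‖∑ m ∈ s, (σ m : ℂ) * φ m y‖ : ℂ) := by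
      generalize ∑ m ∈ s, (σ m : ℂ) * φ m y = w
      rcases eq_or_ne w 0 with rfl | hw
      · exact ⟨1, by simp⟩
      · refine ⟨(starRingEnd ℂ w) / ‖w‖, by simp [hw], ?_⟩
        have : (‖w‖ : ℂ) ≠ 0 := by simpa using hw
        field_simp
        rw [mul_comm, Complex.mul_conj']
    have h4 := h2 ⟨u • y, B.smul_mem u hy⟩
    have h5 : ∑ m ∈ s, σ m * f m ⟨u • y, B.smul_mem u hy⟩ = ‖∑ m ∈ s, (σ m : ℂ) * φ m y‖ := by
      have := congrArg Complex.re hu2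
      rw [Complex.ofReal_re] at this
      rw [← this, Finset.mul_sum, Complex.re_sum]
      refine Finset.sum_congr rfl fun m _ => ?_
      rw [hf, map_smul, smul_eq_mul, mul_left_comm, Complex.re_ofReal_mul]
    rw [h5, hp₁, hq₁, hsN] at h4
    have h6 := hK (u • y)
    rw [norm_smul, hu1, one_mul] at h6
    simp only [norm_smul, hu1, one_mul] at h4
    have h7 : √(N : ℝ) * (δ⁻¹ * q (u • y)) ≤ √(N : ℝ) * (δ⁻¹ * (K * ‖y‖)) := by gcongr
    linarith)
  have h4 : ∑ m ∈ s, ‖(σ m : ℂ)‖ = N := by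
    simp [h1, hsN]
  rw [h4] at h3
  have hpos : 0 < rr - r' := sub_pos.2 hrr
  have hNpos : (0 : ℝ) < N := by nlinarith [sq_nonneg (K / δ / (rr - r'))]
  have hsq : √(N : ℝ) * √(N : ℝ) = N := Real.mul_self_sqrt hNpos.le
  have hs0 : 0 < √(N : ℝ) := Real.sqrt_pos.2 hNpos
  have h5 : √(N : ℝ) * (√(N : ℝ) * (rr - r')) ≤ √(N : ℝ) * (δ⁻¹ * K) := by
    rw [← mul_assoc, hsq]; linarith
  have h6 := le_of_mul_le_mul_left h5 hs0
  have h7 : √(N : ℝ) ≤ K / δ / (rr - r') := by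
    rw [le_div_iff₀ hpos]
    calc _ ≤ δ⁻¹ * K := h6
      _ = K / δ := by ring
  have h8 : √(N : ℝ) * √(N : ℝ) ≤ (K / δ / (rr - r')) ^ 2 := by
    rw [← sq]; exact pow_le_pow_left₀ hs0.le h7 2
  linarith

/-- Submodule of elements orthogonal to all elements of `S`. -/
def auxOrth (S : Set A) : Submodule ℂ A where
  carrier := {y | ∀ z ∈ S, y * star z = 0 ∧ star z * y = 0}
  zero_mem' := by intro z _; simp
  add_mem' := by
    intro a b ha hb z hz
    simp [add_mul, mul_add, ha z hz, hb z hz]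
  smul_mem' := by
    intro t a ha z hz
    rw [smul_mul_assoc, mul_smul_comm, (ha z hz).1, (ha z hz).2]; simp

theorem mem_auxOrth {S : Set A} {y : A} :
    y ∈ auxOrth S ↔ ∀ z ∈ S, y * star z = 0 ∧ star z * y = 0 := Iff.rfl

theorem aux_limit (U : Ultrafilter ℕ) (ψ : ℕ → A →ₗ[ℝ] ℝ) (h : ∀ k a, ψ k a ≤ ‖a‖) :
    ∃ ψ' : A →ₗ[ℝ] ℝ, (∀ a, ψ' a ≤ ‖a‖) ∧
      ∀ a, Filter.Tendsto (fun k => ψ k a) U (nhds (ψ' a)) := by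
  have h1 : ∀ a, ∃ l, Filter.Tendsto (fun k => ψ k a) U (nhds l) := by
    intro a
    have := (isCompact_Icc (a := -‖a‖) (b := ‖a‖)).ultrafilter_le_nhds
      (U.map (fun k => ψ k a)) (by
        rw [Filter.le_principal_iff]
        refine (show ∀ᶠ k in (U : Filter ℕ), ψ k a ∈ Set.Icc (-‖a‖) ‖a‖ from
          Filter.Eventually.of_forall fun k => ⟨?_, h k a⟩)
        have := h k (-a)
        rw [map_neg, norm_neg] at this
        linarith)
    obtain ⟨l, -, hl⟩ := this
    exact ⟨l, hl⟩
  choose l hl using h1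
  refine ⟨{ toFun := l, map_add' := ?_, map_smul' := ?_ }, fun a => ?_, hl⟩
  · intro a b
    refine tendsto_nhds_unique (hl (a + b)) ?_
    simpa using (hl a).add (hl b)
  · intro t a
    refine tendsto_nhds_unique (hl (t • a)) ?_
    simpa using (hl a).const_mul t
  · exact le_of_tendsto (hl a) (Filter.Eventually.of_forall fun k => h k a)
end aux4

section aux5
variable {A : Type*} [NonUnitalCStarAlgebra A]

theorem aux_dom (φ : A →L[ℂ] ℂ) (hφ : ‖φ‖ ≤ 1) :
    ∃ ψ ψ' : A →ₗ[ℝ] ℝ, (∀ a, ψ a ≤ ‖a‖) ∧ (∀ a, ψ' a ≤ ‖a‖) ∧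
      (∀ e, 0 ≤ ψ (star e * e)) ∧ (∀ e, 0 ≤ ψ' (e * star e)) ∧
      (∀ x e, ‖φ (x * e)‖ ^ 2 ≤ ψ (star e * e) * ‖x‖ ^ 2) ∧
      (∀ x e, ‖φ (e * x)‖ ^ 2 ≤ ψ' (e * star e) * ‖x‖ ^ 2) := by
  obtain ⟨ψ, h1, h2⟩ := aux_dominate_right φ hφ
  obtain ⟨ψ', h1', h2'⟩ := aux_dominate_left φ hφ
  refine ⟨ψ, ψ', h1, h1', fun e => ?_, fun e => ?_, fun x e => ?_, fun x e => ?_⟩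
  · simpa using h2 0 e (by simp)
  · simpa using h2' 0 e (by simp)
  · rcases eq_or_ne x 0 with rfl | hx
    · simp
    · have hx' : 0 < ‖x‖ := norm_pos_iff.2 hx
      have := h2 (((‖x‖⁻¹ : ℝ) : ℂ) • x) e (by rw [norm_smul]; simp [hx])
      rw [smul_mul_assoc, map_smul, norm_smul, Complex.norm_real, norm_inv, norm_norm, mul_pow,
        inv_pow, inv_mul_le_iff₀ (by positivity)] at this
      linarith
  · rcases eq_or_ne x 0 with rfl | hx
    · simp
    · have hx' : 0 < ‖x‖ := norm_pos_iff.2 hx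
      have := h2' (((‖x‖⁻¹ : ℝ) : ℂ) • x) e (by rw [norm_smul]; simp [hx])
      rw [mul_smul_comm, map_smul, norm_smul, Complex.norm_real, norm_inv, norm_norm, mul_pow,
        inv_pow, inv_mul_le_iff₀ (by positivity)] at this
      linarith

theorem aux_cfc_left (x : A) (η : ℝ) (hη : 0 < η) : ∃ f e : A, star f = f ∧ star e = e ∧
    e * f = f ∧ ‖f‖ ≤ 1 ∧ ‖x - f * x‖ ≤ η ∧
    (∃ z, ((2 / η ^ 2 : ℝ)) • (x * star x) - e * e = z * star z) ∧
    (∀ y, ‖y - e * y‖ ≤ ‖y‖) ∧ (∃ g, f = (x * star x) * g) ∧ (∃ g, e = (x * star x) * g) := by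
  obtain ⟨f, e, hf, he, hfe, hf1, hx, ⟨z, hz⟩, hy, ⟨g, hg⟩, ⟨g', hg'⟩⟩ := aux_cfc (star x) η hη
  refine ⟨f, e, hf, he, ?_, hf1, ?_, ⟨star z, ?_⟩, fun y => ?_, ⟨star g, ?_⟩, ⟨star g', ?_⟩⟩
  · simpa [hf, he] using congrArg star hfe
  · rw [← norm_star]; simpa [hf] using hx
  · simpa using hz
  · rw [← norm_star, ← norm_star y]; simpa [he] using hy (star y)
  · simpa [hf] using congrArg star hg
  · simpa [he] using congrArg star hg'

set_option maxHeartbeats 2000000 in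
theorem aux_step (φ : ℕ → A →L[ℂ] ℂ) (hφ : ∀ m x, ‖φ m x‖ ≤ ‖x‖)
    (ψ ψ' : ℕ → A →ₗ[ℝ] ℝ) (hψ1 : ∀ k a, ψ k a ≤ ‖a‖) (hψ1' : ∀ k a, ψ' k a ≤ ‖a‖)
    (hψ0 : ∀ k e, 0 ≤ ψ k (star e * e)) (hψ0' : ∀ k e, 0 ≤ ψ' k (e * star e))
    (hψ : ∀ k x e, ‖φ k (x * e)‖ ^ 2 ≤ ψ k (star e * e) * ‖x‖ ^ 2)
    (hψ' : ∀ k x e, ‖φ k (e * x)‖ ^ 2 ≤ ψ' k (e * star e) * ‖x‖ ^ 2)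
    (M : Set ℕ) (hM : M ∈ Filter.hyperfilter ℕ) (Used : Finset ℕ) (S : Set A)
    (rr r' d D : ℝ) (hd : 0 < d) (hD : 0 < D) (hDr : D < r') (hrr : r' < rr)
    (R : ∀ s : Finset ℕ, (s : Set ℕ) ⊆ M → ∀ α : ℕ → ℂ, ∀ C : ℝ, 0 ≤ C →
      (∀ y ∈ auxOrth S, ‖∑ m ∈ s, α m * φ m y‖ ≤ C * ‖y‖) → rr * ∑ m ∈ s, ‖α m‖ ≤ C) :
    ∃ m ∈ M, (∀ i ∈ Used, i < m) ∧ ∃ c ∈ auxOrth S, ‖c‖ = 1 ∧ r' - D < (φ m c).re ∧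
      ∃ M' ⊆ M, M' ∈ Filter.hyperfilter ℕ ∧ (∀ k ∈ M', ‖φ k c‖ ≤ d) ∧
      (∀ k ∈ Used, ‖φ k c‖ ≤ d) ∧
      (∀ s : Finset ℕ, (s : Set ℕ) ⊆ M' → ∀ α : ℕ → ℂ, ∀ C : ℝ, 0 ≤ C →
        (∀ y ∈ auxOrth (insert c S), ‖∑ m ∈ s, α m * φ m y‖ ≤ C * ‖y‖) →
          (rr - d) * ∑ m ∈ s, ‖α m‖ ≤ C) := by
  obtain ⟨P, hP1, hP⟩ := aux_limit (Filter.hyperfilter ℕ) ψ hψ1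
  obtain ⟨P', hP1', hP'⟩ := aux_limit (Filter.hyperfilter ℕ) ψ' hψ1'
  have hP0 : ∀ e, 0 ≤ P (star e * e) := fun e =>
    ge_of_tendsto (hP _) (Filter.Eventually.of_forall fun k => hψ0 k e)
  have hP0' : ∀ e, 0 ≤ P' (e * star e) := fun e =>
    ge_of_tendsto (hP' _) (Filter.Eventually.of_forall fun k => hψ0' k e)
  obtain ⟨q, hq⟩ := aux_seminorm (P + ∑ i ∈ Used, ψ i) (P' + ∑ i ∈ Used, ψ' i)
    (fun x => by
      simp only [LinearMap.add_apply, LinearMap.sum_apply]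
      exact add_nonneg (hP0 x) (Finset.sum_nonneg fun i _ => hψ0 i x))
    (fun x => by
      simp only [LinearMap.add_apply, LinearMap.sum_apply]
      exact add_nonneg (hP0' x) (Finset.sum_nonneg fun i _ => hψ0' i x))
  have hpar : ∀ x y, q (x + y) ^ 2 + q (x - y) ^ 2 = 2 * q x ^ 2 + 2 * q y ^ 2 := by
    intro x y
    simp only [hq, star_add, star_sub, add_mul, mul_add, sub_mul, mul_sub, map_add, map_sub]
    ring
  have hn1 : ∀ x : A, ‖star x * x‖ = ‖x‖ ^ 2 := fun x => by
    rw [CStarRing.norm_star_mul_self, sq]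
  have hn2 : ∀ x : A, ‖x * star x‖ = ‖x‖ ^ 2 := fun x => by
    rw [CStarRing.norm_self_mul_star, sq]
  obtain ⟨K, hK0, hK⟩ : ∃ K : ℝ, 0 ≤ K ∧ ∀ x, q x ≤ K * ‖x‖ := by
    refine ⟨√(2 + 2 * Used.card), by positivity, fun x => ?_⟩
    refine le_of_sq_le_sq ?_ (by positivity)
    rw [mul_pow, Real.sq_sqrt (by positivity), hq]
    simp only [LinearMap.add_apply, LinearMap.sum_apply]
    have e1 : ∑ i ∈ Used, ψ i (star x * x) ≤ Used.card * ‖x‖ ^ 2 := by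
      rw [← nsmul_eq_mul]
      exact Finset.sum_le_card_nsmul _ _ _ fun i _ => (hψ1 i _).trans (hn1 x).le
    have e2 : ∑ i ∈ Used, ψ' i (x * star x) ≤ Used.card * ‖x‖ ^ 2 := by
      rw [← nsmul_eq_mul]
      exact Finset.sum_le_card_nsmul _ _ _ fun i _ => (hψ1' i _).trans (hn2 x).le
    have e3 := hP1 (star x * x)
    have e4 := hP1' (x * star x)
    rw [hn1] at e3
    rw [hn2] at e4
    linarith
  obtain ⟨T, hT⟩ : ∃ T : Set ℕ, T = M ∩ {k | ∀ i ∈ Used, i < k} := ⟨_, rfl⟩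
  have hTU : T ∈ Filter.hyperfilter ℕ := by
    rw [hT]
    refine Filter.inter_mem hM ?_
    refine Filter.mem_hyperfilter_of_finite_compl ?_
    refine (Set.finite_Iic (Used.sup id)).subset fun k hk => ?_
    simp only [Set.mem_compl_iff, Set.mem_ofPred_eq, not_forall, not_lt] at hk
    obtain ⟨i, hi, hki⟩ := hk
    exact hki.trans (Finset.le_sup (f := id) hi)
  have hTinf : T.Infinite := fun h => Filter.notMem_hyperfilter_of_finite h hTU
  have hTM : T ⊆ M := by rw [hT]; exact Set.inter_subset_left
  obtain ⟨η, hη⟩ : ∃ η : ℝ, η = D / 2 := ⟨_, rfl⟩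
  have hη0 : 0 < η := by rw [hη]; positivity
  obtain ⟨δ, hδ⟩ : ∃ δ : ℝ, δ = d * η / 4 := ⟨_, rfl⟩
  have hδ0 : 0 < δ := by rw [hδ]; positivity
  obtain ⟨m, hm, x, hxB, hx1, hxq, hxm⟩ := aux_find φ hφ (auxOrth S) q hpar K hK0 hK T hTinf rr r' δ
    (hD.le.trans hDr.le) hrr hδ0 (fun s hs => R s (hs.trans hTM))
  obtain ⟨f, e, hf, he, hfe, hf1, hxf, ⟨z, hz⟩, hy, ⟨g, hg⟩, ⟨g', hg'⟩⟩ := aux_cfc x η hη0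
  obtain ⟨f₂, e₂, hf₂, he₂, hfe₂, hf1₂, hxf₂, ⟨z₂, hz₂⟩, hy₂, ⟨g₂, hg₂⟩, ⟨g₂', hg₂'⟩⟩ :=
    aux_cfc_left x η hη0
  have hnc : ‖f₂ * x * f‖ ≤ 1 := by
    calc ‖f₂ * x * f‖ ≤ ‖f₂‖ * ‖x‖ * ‖f‖ := norm_mul₃_le
      _ ≤ 1 * 1 * 1 := by gcongr
      _ = 1 := by norm_num
  have hxc : ‖x - f₂ * x * f‖ ≤ D := by
    have : x - f₂ * x * f = (x - f₂ * x) + f₂ * (x - x * f) := by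
      rw [mul_sub, mul_assoc]; abel
    rw [this]
    calc _ ≤ ‖x - f₂ * x‖ + ‖f₂‖ * ‖x - x * f‖ :=
          (norm_add_le _ _).trans (by gcongr; exact norm_mul_le _ _)
      _ ≤ η + 1 * η := by gcongr
      _ = D := by rw [hη]; ring
  obtain ⟨c₀, hc₀⟩ : ∃ c₀, c₀ = f₂ * x * f := ⟨_, rfl⟩
  rw [← hc₀] at hnc hxc
  have hre0 : r' - D < (φ m c₀).re := by
    have h1 := (Complex.re_le_norm _).trans (hφ m (x - c₀))
    rw [map_sub, Complex.sub_re] at h1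
    linarith
  have hc0 : c₀ ≠ 0 := by
    rintro h
    rw [h, map_zero, Complex.zero_re] at hre0
    linarith
  have hc0' : 0 < ‖c₀‖ := norm_pos_iff.2 hc0
  have hc₀e : c₀ * e = c₀ := by rw [hc₀, mul_assoc, hfe]
  have hc₀e₂ : e₂ * c₀ = c₀ := by rw [hc₀, ← mul_assoc, ← mul_assoc, hfe₂]
  have hc₀B : c₀ ∈ auxOrth S := by
    intro w hw
    obtain ⟨hw1, hw2⟩ := hxB w hw
    constructor
    · rw [hc₀, hg]
      simp only [mul_assoc, hw1, mul_zero]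
    · rw [hc₀, hg₂]
      simp only [← mul_assoc, hw2, zero_mul]
  obtain ⟨c, hc⟩ : ∃ c, c = ((‖c₀‖⁻¹ : ℝ) : ℂ) • c₀ := ⟨_, rfl⟩
  have hce : c * e = c := by rw [hc, smul_mul_assoc, hc₀e]
  have hce₂ : e₂ * c = c := by rw [hc, mul_smul_comm, hc₀e₂]
  have hcB : c ∈ auxOrth S := by rw [hc]; exact Submodule.smul_mem _ _ hc₀B
  have hc1 : ‖c‖ = 1 := by rw [hc, norm_smul]; simp [hc0]
  obtain ⟨Good, hGood⟩ : ∃ Good : Set ℕ,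
      Good = {k | ψ k (star x * x) + ψ' k (x * star x) < δ ^ 2} := ⟨_, rfl⟩
  have hqx : q x ^ 2 < δ ^ 2 := pow_lt_pow_left₀ hxq (apply_nonneg q x) two_ne_zero
  rw [hq] at hqx
  simp only [LinearMap.add_apply, LinearMap.sum_apply] at hqx
  have hGoodU : Good ∈ Filter.hyperfilter ℕ := by
    have hlim := (hP (star x * x)).add (hP' (x * star x))
    have h1 : P (star x * x) + P' (x * star x) < δ ^ 2 := by
      have e1 : 0 ≤ ∑ i ∈ Used, ψ i (star x * x) := Finset.sum_nonneg fun i _ => hψ0 i x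
      have e2 : 0 ≤ ∑ i ∈ Used, ψ' i (x * star x) := Finset.sum_nonneg fun i _ => hψ0' i x
      linarith
    rw [hGood]
    exact hlim.eventually_lt_const h1
  have hUsed : ∀ k ∈ Used, k ∈ Good := by
    intro k hk
    rw [hGood]
    have e1 := Finset.single_le_sum (f := fun i => ψ i (star x * x)) (fun i _ => hψ0 i x) hk
    have e2 := Finset.single_le_sum (f := fun i => ψ' i (x * star x)) (fun i _ => hψ0' i x) hk
    have e3 := hP0 x
    have e4 := hP0' x
    simp only [Set.mem_ofPred_eq]
    linarith
  have hδd : 2 / η ^ 2 * δ ^ 2 = d ^ 2 / 8 := by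
    rw [hδ]; field_simp; norm_num
  have hGe : ∀ k ∈ Good, ∀ w, ‖φ k (w * e)‖ ≤ d / 2 * ‖w‖ := by
    intro k hk w
    rw [hGood] at hk
    have h1 := congrArg (ψ k) hz
    rw [map_sub, map_smul, smul_eq_mul] at h1
    have h2 := hψ0 k z
    have h3 := hψ k w e
    rw [he] at h3
    have h4 : ψ k (star x * x) ≤ δ ^ 2 := by
      have := hψ0' k x
      simp only [Set.mem_ofPred_eq] at hk
      linarith
    have h5 : ψ k (e * e) ≤ d ^ 2 / 8 := by
      rw [← hδd]
      have : 2 / η ^ 2 * ψ k (star x * x) ≤ 2 / η ^ 2 * δ ^ 2 := by gcongr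
      linarith
    refine le_of_sq_le_sq (h3.trans ?_) (by positivity)
    rw [mul_pow]
    gcongr
    nlinarith
  have hGe₂ : ∀ k ∈ Good, ∀ w, ‖φ k (e₂ * w)‖ ≤ d / 2 * ‖w‖ := by
    intro k hk w
    rw [hGood] at hk
    have h1 := congrArg (ψ' k) hz₂
    rw [map_sub, map_smul, smul_eq_mul] at h1
    have h2 := hψ0' k z₂
    have h3 := hψ' k w e₂
    rw [he₂] at h3
    have h4 : ψ' k (x * star x) ≤ δ ^ 2 := by
      have := hψ0 k x
      simp only [Set.mem_ofPred_eq] at hk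
      linarith
    have h5 : ψ' k (e₂ * e₂) ≤ d ^ 2 / 8 := by
      rw [← hδd]
      have : 2 / η ^ 2 * ψ' k (x * star x) ≤ 2 / η ^ 2 * δ ^ 2 := by gcongr
      linarith
    refine le_of_sq_le_sq (h3.trans ?_) (by positivity)
    rw [mul_pow]
    gcongr
    nlinarith
  have hGc : ∀ k ∈ Good, ‖φ k c‖ ≤ d := by
    intro k hk
    have := hGe k hk c
    rw [hce, hc1] at this
    linarith
  refine ⟨m, hTM hm, ?_, c, hcB, hc1, ?_, M ∩ Good, Set.inter_subset_left,
    Filter.inter_mem hM hGoodU, fun k hk => hGc k hk.2, fun k hk => hGc k (hUsed k hk), ?_⟩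
  · rw [hT] at hm; exact hm.2
  · rw [hc, map_smul, smul_eq_mul, Complex.re_ofReal_mul]
    have : 1 ≤ ‖c₀‖⁻¹ := (one_le_inv₀ hc0').2 hnc
    nlinarith
  · intro s hs α C hC0 hC
    have hmain := R s (hs.trans Set.inter_subset_left) α (C + d * ∑ m ∈ s, ‖α m‖)
      (add_nonneg hC0 (mul_nonneg hd.le (Finset.sum_nonneg fun _ _ => norm_nonneg _))) (by
      intro y hyB
      obtain ⟨y', hy'⟩ : ∃ y', y' = (y - e₂ * y) - (y - e₂ * y) * e := ⟨_, rfl⟩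
      have hny' : ‖y'‖ ≤ ‖y‖ := by rw [hy']; exact (hy _).trans (hy₂ _)
      have hy'B : y' ∈ auxOrth (insert c S) := by
        intro w hw
        rcases Set.mem_insert_iff.1 hw with rfl | hw
        · have h1 : e * star w = star w := by simpa [he] using congrArg star hce
          have h2 : star w * e₂ = star w := by simpa [he₂] using congrArg star hce₂
          rw [hy']
          constructor
          · rw [sub_mul, mul_assoc _ e, h1, sub_self]
          · rw [mul_sub, ← mul_assoc, mul_sub, ← mul_assoc, h2, sub_self, zero_mul, sub_zero]
        · obtain ⟨hw1, hw2⟩ := hxB w hw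
          obtain ⟨hv1, hv2⟩ := hyB w hw
          have h1 : e * star w = 0 := by
            rw [hg']; simp only [mul_assoc, hw1, mul_zero]
          have h2 : star w * e₂ = 0 := by
            rw [hg₂']; simp only [← mul_assoc, hw2, zero_mul]
          rw [hy']
          constructor
          · simp only [sub_mul, mul_assoc, h1, hv1, mul_zero, sub_zero]
          · simp only [mul_sub, ← mul_assoc, h2, hv2, zero_mul, sub_zero, sub_mul]
      have hC' := hC y' hy'B
      have hsplit : ∑ m ∈ s, α m * φ m y = ∑ m ∈ s, α m * φ m y' +
          ∑ m ∈ s, α m * φ m (e₂ * y + (y - e₂ * y) * e) := by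
        rw [← Finset.sum_add_distrib]
        refine Finset.sum_congr rfl fun k _ => ?_
        rw [← mul_add, ← map_add]
        congr 2
        rw [hy']; abel
      have hrest : ‖∑ m ∈ s, α m * φ m (e₂ * y + (y - e₂ * y) * e)‖ ≤
          d * (∑ m ∈ s, ‖α m‖) * ‖y‖ := by
        refine (norm_sum_le _ _).trans ?_
        rw [Finset.mul_sum, Finset.sum_mul]
        refine Finset.sum_le_sum fun k hk => ?_
        have hkG : k ∈ Good := (hs hk).2
        have h1 : ‖φ k (e₂ * y + (y - e₂ * y) * e)‖ ≤ d * ‖y‖ := by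
          rw [map_add]
          refine (norm_add_le _ _).trans ?_
          have h2 := hGe₂ k hkG y
          have h3 := hGe k hkG (y - e₂ * y)
          have h4 := mul_le_mul_of_nonneg_left (hy₂ y) (half_pos hd).le
          linarith
        rw [norm_mul]
        calc _ ≤ ‖α k‖ * (d * ‖y‖) := by gcongr
          _ = _ := by ring
      rw [hsplit]
      refine (norm_add_le _ _).trans ?_
      have h5 := mul_le_mul_of_nonneg_left hny' hC0
      linarith)
    linarith
end aux5

section aux6
variable {A : Type*} [NonUnitalCStarAlgebra A]

theorem aux_geom (D : ℝ) (hD : 0 ≤ D) (s : Finset ℕ) :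
    ∑ j ∈ s, D / 4 * (1 / 2) ^ j ≤ D / 2 := by
  rw [← Finset.mul_sum]
  have : ∑ j ∈ s, ((1 : ℝ) / 2) ^ j ≤ 2 := by
    exact (summable_geometric_two.sum_le_tsum s fun i _ => by positivity).trans
      tsum_geometric_two.le
  nlinarith

theorem aux_phase (w : ℂ) : ∃ θ : ℂ, ‖θ‖ ≤ 1 ∧ θ * w = (‖w‖ : ℂ) := by
  rcases eq_or_ne w 0 with rfl | hw
  · exact ⟨1, by simp⟩
  · refine ⟨(starRingEnd ℂ w) / ‖w‖, by simp [hw], ?_⟩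
    have : (‖w‖ : ℂ) ≠ 0 := by simpa using hw
    field_simp
    rw [mul_comm, Complex.mul_conj']

theorem aux_final (f : ℕ → A →L[ℂ] ℂ) (c : ℕ → A) (D ρ : ℝ) (hD : 0 ≤ D)
    (horth : ∀ n k, n ≠ k → c n * star (c k) = 0 ∧ star (c k) * c n = 0)
    (hc : ∀ n, ‖c n‖ = 1) (hre : ∀ n, ρ < (f n (c n)).re)
    (hsmall : ∀ n j, j ≠ n → ‖f n (c j)‖ ≤ D / 4 * (1 / 2) ^ j)
    (s : Finset ℕ) (α : ℕ → ℂ) :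
    ∃ x ∈ closure ((Submodule.span ℂ (Set.range c) : Submodule ℂ A) : Set A), ‖x‖ ≤ 1 ∧
      (ρ - D) * ∑ n ∈ s, ‖α n‖ ≤ ‖∑ n ∈ s, α n * f n x‖ := by
  choose θ hθ1 hθ using fun n => aux_phase (α n * f n (c n))
  refine ⟨∑ n ∈ s, θ n • c n, subset_closure ?_, ?_, ?_⟩
  · exact Submodule.sum_mem _ fun n _ => Submodule.smul_mem _ _ (Submodule.subset_span ⟨n, rfl⟩)
  · exact aux_norm_sum s c θ horth hc hθ1
  · have h1 : ∑ n ∈ s, α n * f n (∑ j ∈ s, θ j • c j) =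
        (∑ n ∈ s, ‖α n * f n (c n)‖ : ℝ) + ∑ n ∈ s, α n * ∑ j ∈ s.erase n, θ j * f n (c j) := by
      push_cast
      rw [← Finset.sum_add_distrib]
      refine Finset.sum_congr rfl fun n hn => ?_
      rw [map_sum, ← Finset.add_sum_erase _ _ hn, mul_add, map_smul, smul_eq_mul,
        ← hθ n]
      simp only [map_smul, smul_eq_mul]
      ring
    have h2 : ‖∑ n ∈ s, α n * ∑ j ∈ s.erase n, θ j * f n (c j)‖ ≤ D / 2 * ∑ n ∈ s, ‖α n‖ := by
      refine (norm_sum_le _ _).trans ?_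
      rw [Finset.mul_sum]
      refine Finset.sum_le_sum fun n _ => ?_
      rw [norm_mul, mul_comm]
      gcongr
      refine (norm_sum_le _ _).trans (le_trans (Finset.sum_le_sum fun j hj => ?_)
        (aux_geom D hD (s.erase n)))
      rw [norm_mul]
      have h3 := hsmall n j (Finset.ne_of_mem_erase hj)
      have h4 := mul_le_mul_of_nonneg_right (hθ1 j) (norm_nonneg (f n (c j)))
      linarith
    have h3 : ρ * ∑ n ∈ s, ‖α n‖ ≤ ∑ n ∈ s, ‖α n * f n (c n)‖ := by
      rw [Finset.mul_sum]
      refine Finset.sum_le_sum fun n _ => ?_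
      rw [norm_mul, mul_comm]
      gcongr
      exact (hre n).le.trans (Complex.re_le_norm _)
    have h4 : 0 ≤ ∑ n ∈ s, ‖α n‖ := Finset.sum_nonneg fun _ _ => norm_nonneg _
    rw [h1]
    have h5 := norm_sub_norm_le ((∑ n ∈ s, ‖α n * f n (c n)‖ : ℝ) : ℂ)
      (-∑ n ∈ s, α n * ∑ j ∈ s.erase n, θ j * f n (c j))
    rw [sub_neg_eq_add, norm_neg, Complex.norm_real] at h5
    have h6 := le_abs_self (∑ n ∈ s, ‖α n * f n (c n)‖)
    rw [← Real.norm_eq_abs] at h6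
    nlinarith

theorem aux_seq (φ : ℕ → A →L[ℂ] ℂ) (hnorm : ∀ m, ‖φ m‖ = 1) (r D : ℝ)
    (hD : 0 < D) (hDr : 2 * D < r)
    (hspan : ∀ s : Finset ℕ, ∀ α : ℕ → ℂ,
      r * ∑ m ∈ s, ‖α m‖ ≤ ‖∑ m ∈ s, α m • φ m‖) :
    ∃ m : ℕ → ℕ, StrictMono m ∧ ∃ c : ℕ → A,
      (∀ n k, n ≠ k → c n * star (c k) = 0 ∧ star (c k) * c n = 0) ∧ (∀ n, ‖c n‖ = 1) ∧
      (∀ n, r - 2 * D < (φ (m n) (c n)).re) ∧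
      (∀ n j, j ≠ n → ‖φ (m n) (c j)‖ ≤ D / 4 * (1 / 2) ^ j) := by
  have hφ : ∀ m x, ‖φ m x‖ ≤ ‖x‖ := fun m x => by
    simpa [hnorm m] using (φ m).le_opNorm x
  choose ψ ψ' a1 a2 a3 a4 a5 a6 using fun m => aux_dom (φ m) (hnorm m).le
  let d : ℕ → ℝ := fun j => D / 4 * (1 / 2) ^ j
  have hd : ∀ j, 0 < d j := fun j => by simp only [d]; positivity
  let Inv : ℕ × Set ℕ × Finset ℕ × Set A → Prop := fun t =>
    t.2.1 ∈ Filter.hyperfilter ℕ ∧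
    ∀ s : Finset ℕ, (s : Set ℕ) ⊆ t.2.1 → ∀ α : ℕ → ℂ, ∀ C : ℝ, 0 ≤ C →
      (∀ y ∈ auxOrth t.2.2.2, ‖∑ m ∈ s, α m * φ m y‖ ≤ C * ‖y‖) →
      (r - ∑ j ∈ Finset.range t.1, d j) * ∑ m ∈ s, ‖α m‖ ≤ C
  have step : ∀ t : {t // Inv t}, ∃ (m : ℕ) (c : A) (t' : {t // Inv t}),
      m ∈ t.1.2.1 ∧ (∀ i ∈ t.1.2.2.1, i < m) ∧ c ∈ auxOrth t.1.2.2.2 ∧ ‖c‖ = 1 ∧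
      r - 2 * D < (φ m c).re ∧ t'.1.2.1 ⊆ t.1.2.1 ∧ (∀ k ∈ t'.1.2.1, ‖φ k c‖ ≤ d t.1.1) ∧
      (∀ k ∈ t.1.2.2.1, ‖φ k c‖ ≤ d t.1.1) ∧ t'.1.1 = t.1.1 + 1 ∧
      t'.1.2.2.1 = insert m t.1.2.2.1 ∧ t'.1.2.2.2 = insert c t.1.2.2.2 := by
    rintro ⟨⟨n, M, Used, S⟩, hM, R⟩
    have hsum : ∑ j ∈ Finset.range n, d j ≤ D / 2 := aux_geom D hD.le _
    obtain ⟨m, hm, hmU, c, hcS, hc1, hre, M', hM'M, hM'U, hs1, hs2, R'⟩ :=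
      aux_step φ hφ ψ ψ' a1 a2 a3 a4 a5 a6 M hM Used S (r - ∑ j ∈ Finset.range n, d j) (r - D)
        (d n) D (hd n) hD (by linarith) (by linarith) R
    refine ⟨m, c, ⟨⟨n + 1, M', insert m Used, insert c S⟩, hM'U, ?_⟩, hm, hmU, hcS, hc1,
      by linarith, hM'M, hs1, hs2, rfl, rfl, rfl⟩
    intro s hs α C hC0 hC
    have := R' s hs α C hC0 hC
    rw [Finset.sum_range_succ]
    rwa [sub_sub] at this
  choose mm cc nxt p1 p2 p3 p4 p5 p6 p7 p8 p9 p10 p11 using step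
  have hinit : Inv (0, Set.univ, ∅, ∅) := by
    refine ⟨Filter.univ_mem, fun s _ α C hC0 hC => ?_⟩
    simp only [Finset.range_zero, Finset.sum_empty, sub_zero]
    refine (hspan s α).trans (ContinuousLinearMap.opNorm_le_bound _ hC0 fun y => ?_)
    simpa using hC y (by intro z hz; exact absurd hz (Set.notMem_empty z))
  let T : ℕ → {t // Inv t} := fun n => Nat.rec ⟨_, hinit⟩ (fun _ t => nxt t) n
  have hT : ∀ n, T (n + 1) = nxt (T n) := fun n => rfl
  have hT0 : (T 0).1.1 = 0 := rfl
  clear_value T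
  have hTn : ∀ n, (T n).1.1 = n := by
    intro n
    induction n with
    | zero => exact hT0
    | succ n ih => rw [hT, p9, ih]
  have hMa : ∀ i j, i ≤ j → (T j).1.2.1 ⊆ (T i).1.2.1 := by
    intro i j hij
    induction hij with
    | refl => exact subset_rfl
    | step _ ih => rw [hT]; exact (p6 _).trans ih
  have hUs : ∀ i j, i < j → mm (T i) ∈ (T j).1.2.2.1 := by
    intro i j hij
    induction hij with
    | refl => rw [hT, p10]; exact Finset.mem_insert_self _ _
    | step _ ih => rw [hT, p10]; exact Finset.mem_insert_of_mem ih
  have hSs : ∀ i j, i < j → cc (T i) ∈ (T j).1.2.2.2 := by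
    intro i j hij
    induction hij with
    | refl => rw [hT, p11]; exact Set.mem_insert _ _
    | step _ ih => rw [hT, p11]; exact Set.mem_insert_of_mem _ ih
  refine ⟨fun n => mm (T n), strictMono_nat_of_lt_succ fun n => ?_, fun n => cc (T n), ?_,
    fun n => p4 _, fun n => p5 _, ?_⟩
  · exact p2 _ _ (hUs n (n + 1) (Nat.lt_succ_self n))
  · intro n k hnk
    rcases lt_or_gt_of_ne hnk with h | h
    · have := p3 (T k) _ (hSs n k h)
      constructor
      · simpa using congrArg star this.1
      · simpa using congrArg star this.2
    · exact p3 (T n) _ (hSs k n h)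
  · intro n j hj
    rcases lt_or_gt_of_ne hj with h | h
    · have h1 := p1 (T n)
      have h2 := hMa (j + 1) n h h1
      rw [hT] at h2
      have := p7 _ _ h2
      rwa [hTn] at this
    · have := p8 _ _ (hUs n j h)
      rwa [hTn] at this
end aux6

theorem l1_r_isomorphic_restriction_to_abelian_part
    {A : Type*} [NonUnitalCStarAlgebra A]
    (r : ℝ) (hr0 : 0 < r) (hr1 : r ≤ 1)
    (φ : ℕ → A →L[ℂ] ℂ) (hnorm : ∀ m, ‖φ m‖ = 1)
    (hspan : ∀ s : Finset ℕ, ∀ α : ℕ → ℂ,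
      r * ∑ m ∈ s, ‖α m‖ ≤ ‖∑ m ∈ s, α m • φ m‖) :
    ∀ ε > (0 : ℝ), ∃ m : ℕ → ℕ, StrictMono m ∧
      ∃ c : ℕ → A,
        (∀ n k, n ≠ k → c n * star (c k) = 0 ∧ star (c k) * c n = 0) ∧
        (∀ n, ‖c n‖ = 1) ∧
        (∀ n, r * (1 - ε) < (φ (m n) (c n)).re) ∧
        (∀ s : Finset ℕ, ∀ α : ℕ → ℂ,
          ∃ x ∈ closure ((Submodule.span ℂ (Set.range c) : Submodule ℂ A) : Set A),
            ‖x‖ ≤ 1 ∧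
            r * (1 - ε) * ∑ n ∈ s, ‖α n‖ ≤ ‖∑ n ∈ s, α n * φ (m n) x‖) := by
  intro ε hε
  obtain ⟨ε', h1, h2, h3⟩ : ∃ ε' : ℝ, 0 < ε' ∧ ε' ≤ ε ∧ ε' ≤ 1 :=
    ⟨min ε 1, lt_min hε one_pos, min_le_left _ _, min_le_right _ _⟩
  obtain ⟨D, hD⟩ : ∃ D : ℝ, D = r * ε' / 4 := ⟨_, rfl⟩
  have hD0 : 0 < D := by rw [hD]; positivity
  have hDr : 4 * D ≤ r := by rw [hD]; nlinarith
  have hDe : r * (1 - ε) ≤ r - 4 * D := by rw [hD]; nlinarith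
  obtain ⟨m, hm, c, horth, hc, hre, hsm⟩ := aux_seq φ hnorm r D hD0 (by linarith) hspan
  refine ⟨m, hm, c, horth, hc, fun n => lt_of_le_of_lt (by linarith) (hre n), fun s α => ?_⟩
  obtain ⟨x, hx, hx1, hx2⟩ := aux_final (fun n => φ (m n)) c D (r - 2 * D) hD0.le horth hc hre hsm s α
  refine ⟨x, hx, hx1, le_trans ?_ hx2⟩
  exact mul_le_mul_of_nonneg_right (by linarith) (Finset.sum_nonneg fun _ _ => norm_nonneg _)
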